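/- (Theorem 1, item 2: attraction.) Let m ≥ 2, r₁,…,rₘ ∈ ℝ³ with at least two linearly independent, αᵢ, δᵢ, ρᵢ > 0, k > 0, W = −Σᵢ ρᵢ S(rᵢ)², and let λ_min(W) > 0 be its smallest eigenvalue. Let (b̄₁,…,b̄ₘ, q̄₀, q̄, ω̄) : [0,∞) → ℝ^{3m} × ℝ × ℝ³ × ℝ³ be differentiable, satisfy q̄₀(t)² + ‖q̄(t)‖² = 1 for all t, and solve the closed-loop tracking-error system: b̄ᵢ' = −αᵢ b̄ᵢ − δᵢ S(rᵢ)ω̄, q̄₀' = −½ q̄ᵀω̄, q̄' = ½(q̄₀ I₃ + S(q̄))ω̄, ω̄' = −2(q̄₀ I₃ − S(q̄))Wq̄ − Σᵢ ρᵢ S(rᵢ) b̄ᵢ − k ω̄. Define V₃ = Σᵢ (ρᵢ/δᵢ)‖b̄ᵢ‖² + 4 q̄ᵀWq̄ + ‖ω̄‖². If at t = 0 one has V₃(0) < 4λ_min(W) and q̄₀(0) > 0, then as t → ∞: b̄ᵢ(t) → 0 for all i, ω̄(t) → 0, q̄(t) → 0 and q̄₀(t) → 1. Symmetrically, if V₃(0)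 < 4λ_min(W) and q̄₀(0) < 0, then b̄ᵢ(t) → 0, ω̄(t) → 0, q̄(t) → 0 and q̄₀(t) → −1. -/

import Mathlib

open Matrix

/-- `skew x` is the matrix `S(x)` with `S(x) y = x × y`. -/
def skew (x : Fin 3 → ℝ) : Matrix (Fin 3) (Fin 3) ℝ :=
  !![0, -x 2, x 1; x 2, 0, -x 0; -x 1, x 0, 0]

theorem hasDerivAt_dot {n : ℕ} {f g : ℝ → Fin n → ℝ} {f' g' : Fin n → ℝ} {t : ℝ}
    (hf : HasDerivAt f f' t) (hg : HasDerivAt g g' t) :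
    HasDerivAt (fun s => f s ⬝ᵥ g s) (f' ⬝ᵥ g t + f t ⬝ᵥ g') t := by
  rw [hasDerivAt_pi] at hf hg
  simp only [dotProduct, ← Finset.sum_add_distrib]
  exact HasDerivAt.fun_sum fun i _ => (hf i).mul (hg i)

theorem hasDerivAt_mulVec (W : Matrix (Fin 3) (Fin 3) ℝ) {g : ℝ → Fin 3 → ℝ} {g' : Fin 3 → ℝ}
    {t : ℝ} (hg : HasDerivAt g g' t) :
    HasDerivAt (fun s => W.mulVec (g s)) (W.mulVec g') t := by
  rw [hasDerivAt_pi]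
  intro i
  have := hasDerivAt_dot (hasDerivAt_const t (W i)) hg
  simpa [mulVec] using this

theorem skew_swap (r x y : Fin 3 → ℝ) :
    x ⬝ᵥ (skew r).mulVec y = - (y ⬝ᵥ (skew r).mulVec x) := by
  simp [skew, dotProduct, mulVec, Fin.sum_univ_three]; ring

theorem skew_self (x y : Fin 3 → ℝ) : x ⬝ᵥ (skew x).mulVec y = 0 := by
  simp [skew, dotProduct, mulVec, Fin.sum_univ_three]; ring

theorem skew_transpose (r : Fin 3 → ℝ) : (skew r)ᵀ = - skew r := by
  ext i j; fin_cases i <;> fin_cases j <;> simp [skew]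

theorem dot_sq_le {n : ℕ} (x y : Fin n → ℝ) : (x ⬝ᵥ y) ^ 2 ≤ (x ⬝ᵥ x) * (y ⬝ᵥ y) := by
  have := Finset.sum_mul_sq_le_sq_mul_sq Finset.univ x y
  simpa [dotProduct, sq] using this

theorem dot_self_nonneg' {n : ℕ} (x : Fin n → ℝ) : 0 ≤ x ⬝ᵥ x :=
  Finset.sum_nonneg fun i _ => mul_self_nonneg (x i)

theorem rayleigh (W : Matrix (Fin 3) (Fin 3) ℝ) (hs : Wᵀ = W) (lam : ℝ)
    (h : ∀ t : ℝ, (∃ x : Fin 3 → ℝ, x ≠ 0 ∧ W.mulVec x = t • x) → lam ≤ t) (x : Fin 3 → ℝ) :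
    lam * (x ⬝ᵥ x) ≤ x ⬝ᵥ W.mulVec x := by
  have hH : (W - lam • (1 : Matrix (Fin 3) (Fin 3) ℝ)).IsHermitian := by
    rw [Matrix.IsHermitian, conjTranspose_eq_transpose_of_trivial]
    simp [hs]
  have hp : (W - lam • (1 : Matrix (Fin 3) (Fin 3) ℝ)).PosSemidef := by
    rw [hH.posSemidef_iff_eigenvalues_nonneg]
    intro i
    have h1 := hH.mulVec_eigenvectorBasis i
    have h2 := h (hH.eigenvalues i + lam) ⟨(hH.eigenvectorBasis i).ofLp, ?_, ?_⟩
    · simpa using h2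
    · intro h0
      have := hH.eigenvectorBasis.orthonormal.ne_zero i
      apply this
      ext j
      simp [h0]
    · rw [sub_mulVec, smul_mulVec, one_mulVec, sub_eq_iff_eq_add] at h1
      rw [h1, add_smul]
  have := hp.dotProduct_mulVec_nonneg x
  rw [sub_mulVec, smul_mulVec, one_mulVec] at this
  simp at this
  linarith

theorem expdecay (U U' V : ℝ → ℝ) (ν : ℝ) (hν : 0 < ν)
    (hU : ∀ t ≥ (0:ℝ), HasDerivAt U (U' t) t) (hd : ∀ t ≥ (0:ℝ), U' t ≤ -ν * U t)
    (hV : ∀ t ≥ (0:ℝ), 0 ≤ V t) (hVU : ∀ t ≥ (0:ℝ), V t ≤ 2 * U t) :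
    Filter.Tendsto V Filter.atTop (nhds 0) := by
  have hE : ∀ t ≥ (0:ℝ), HasDerivAt (fun s => U s * Real.exp (ν * s))
      (U' t * Real.exp (ν * t) + U t * (Real.exp (ν * t) * ν)) t := by
    intro t ht
    have h1 : HasDerivAt (fun s => ν * s) ν t := by simpa using (hasDerivAt_id t).const_mul ν
    exact (hU t ht).mul h1.exp
  have hanti : AntitoneOn (fun s => U s * Real.exp (ν * s)) (Set.Ici 0) := by
    apply antitoneOn_of_deriv_nonpos (convex_Ici 0)
    · intro t ht; exact (hE t ht).continuousAt.continuousWithinAt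
    · intro t ht
      rw [interior_Ici] at ht
      exact (hE t (le_of_lt ht)).differentiableAt.differentiableWithinAt
    · intro t ht
      rw [interior_Ici] at ht
      rw [(hE t (le_of_lt ht)).deriv]
      have := hd t (le_of_lt ht)
      have h2 := Real.exp_pos (ν * t)
      nlinarith
  have hb : ∀ t ≥ (0:ℝ), V t ≤ 2 * U 0 * Real.exp (-(ν * t)) := by
    intro t ht
    have h1 := hanti (Set.mem_Ici.2 le_rfl) (Set.mem_Ici.2 ht) ht
    simp only [mul_zero, Real.exp_zero, mul_one] at h1
    have h2 := Real.exp_pos (-(ν * t))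
    have h3 : Real.exp (ν * t) * Real.exp (-(ν * t)) = 1 := by
      rw [← Real.exp_add]; simp
    have h4 := hVU t ht
    have h5 : U t ≤ U 0 * Real.exp (-(ν * t)) := by
      calc U t = U t * Real.exp (ν * t) * Real.exp (-(ν * t)) := by rw [mul_assoc, h3, mul_one]
        _ ≤ _ := by gcongr
    linarith
  have hlim : Filter.Tendsto (fun t => 2 * U 0 * Real.exp (-(ν * t))) Filter.atTop (nhds 0) := by
    have := (Real.tendsto_exp_neg_atTop_nhds_zero.comp
      (Filter.tendsto_id.const_mul_atTop hν)).const_mul (2 * U 0)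
    simpa [Function.comp_def] using this
  refine tendsto_of_tendsto_of_tendsto_of_le_of_le' tendsto_const_nhds hlim ?_ ?_
  · filter_upwards [Filter.eventually_ge_atTop 0] with t ht using hV t ht
  · filter_upwards [Filter.eventually_ge_atTop 0] with t ht using hb t ht

theorem tendsto_zero_of_dot {n : ℕ} (f : ℝ → Fin n → ℝ)
    (h : Filter.Tendsto (fun t => f t ⬝ᵥ f t) Filter.atTop (nhds 0)) :
    Filter.Tendsto f Filter.atTop (nhds 0) := by
  rw [tendsto_pi_nhds]
  intro i
  have h1 : Filter.Tendsto (fun t => (f t i) ^ 2) Filter.atTop (nhds 0) := by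
    refine squeeze_zero (fun t => sq_nonneg _) (fun t => ?_) h
    have := Finset.single_le_sum (f := fun j => f t j * f t j)
      (fun j _ => mul_self_nonneg _) (Finset.mem_univ i)
    rw [sq]; exact this
  have h2 := h1.sqrt
  simp only [Real.sqrt_sq_eq_abs, Real.sqrt_zero] at h2
  exact (tendsto_zero_iff_abs_tendsto_zero _).2 h2

theorem exists_pos_le {m : ℕ} (α : Fin m → ℝ) (hα : ∀ i, 0 < α i) :
    ∃ a > 0, ∀ i, a ≤ α i := by
  induction m with
  | zero => exact ⟨1, one_pos, fun i => i.elim0⟩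
  | succ n ih =>
    obtain ⟨a, ha, h⟩ := ih (fun i => α i.succ) (fun i => hα _)
    refine ⟨min a (α 0), lt_min ha (hα 0), fun i => ?_⟩
    refine Fin.cases (min_le_right _ _) (fun j => (min_le_left _ _).trans (h j)) i

/-- bound for `q · Σ ρ S(r) b` -/
theorem cross_bound {m : ℕ} (r : Fin m → Fin 3 → ℝ) (δ ρ : Fin m → ℝ) (hδ : ∀ i, 0 < δ i)
    (hρ : ∀ i, 0 < ρ i) (η : ℝ) (hη : 0 < η) : ∃ C > 0, ∀ (b : Fin m → Fin 3 → ℝ)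
      (q : Fin 3 → ℝ) (s : ℝ), s ^ 2 ≤ 1 →
      -(s * (q ⬝ᵥ ∑ i, ρ i • (skew (r i)).mulVec (b i))) ≤
        η * (q ⬝ᵥ q) + C * ∑ i, (ρ i / δ i) * (b i ⬝ᵥ b i) := by
  -- `q · S(r) b = - b · S(r) q`, Cauchy-Schwarz termwise
  set D : ℝ := (∑ i, ρ i * δ i * (r i ⬝ᵥ r i)) + 1 with hD
  have hD0 : 0 ≤ ∑ i, ρ i * δ i * (r i ⬝ᵥ r i) :=
    Finset.sum_nonneg fun i _ => mul_nonneg (mul_pos (hρ i) (hδ i)).le (dot_self_nonneg' _)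
  have hDp : 0 < D := by linarith
  refine ⟨D / (4 * η), by positivity, fun b q s hs => ?_⟩
  have hterm : ∀ i, -(s * (q ⬝ᵥ (ρ i • (skew (r i)).mulVec (b i)))) ≤
      η / D * (ρ i * δ i * (r i ⬝ᵥ r i)) * (q ⬝ᵥ q) +
        D / (4 * η) * ((ρ i / δ i) * (b i ⬝ᵥ b i)) := by
    intro i
    have h1 : q ⬝ᵥ (ρ i • (skew (r i)).mulVec (b i)) = -ρ i * (b i ⬝ᵥ (skew (r i)).mulVec q) := by
      rw [dotProduct_smul, skew_swap]; simp
    set y := (skew (r i)).mulVec q with hy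
    have hyy : y ⬝ᵥ y ≤ (r i ⬝ᵥ r i) * (q ⬝ᵥ q) := by
      have : y ⬝ᵥ y = (r i ⬝ᵥ r i) * (q ⬝ᵥ q) - (r i ⬝ᵥ q) ^ 2 := by
        rw [hy]; simp [skew, dotProduct, mulVec, Fin.sum_univ_three]; ring
      rw [this]; nlinarith [sq_nonneg (r i ⬝ᵥ q)]
    have hcs := dot_sq_le (b i) y
    rw [h1]
    have hρi := hρ i
    have hδi := hδ i
    have hbb := dot_self_nonneg' (b i)
    have hyn := dot_self_nonneg' y
    set β := b i ⬝ᵥ b i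
    set Y := y ⬝ᵥ y
    set z := b i ⬝ᵥ y
    have key : s * z ≤ η / D * δ i * Y + D / (4 * η) * (β / δ i) := by
      set u := η / D * δ i with hu
      have hup : 0 < u := by positivity
      have : D / (4 * η) * (β / δ i) = β / (4 * u) := by
        rw [hu]; field_simp
      rw [this]
      have h2 : (s * z) ^ 2 ≤ β * Y := by
        rw [mul_pow]; nlinarith [sq_nonneg z]
      have h3 : (s * z) ^ 2 ≤ (u * Y + β / (4 * u)) ^ 2 := by
        have : (u * Y + β / (4 * u)) ^ 2 = (u * Y - β / (4 * u)) ^ 2 + β * Y := by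
          field_simp; ring
        nlinarith [sq_nonneg (u * Y - β / (4 * u))]
      exact (le_abs_self _).trans (abs_le_of_sq_le_sq h3 (by positivity))
    have h4 : η / D * δ i * Y ≤ η / D * δ i * ((r i ⬝ᵥ r i) * (q ⬝ᵥ q)) := by gcongr
    have h5 := mul_le_mul_of_nonneg_left (key.trans (add_le_add_left h4 _)) hρi.le
    calc _ = ρ i * (s * z) := by ring
      _ ≤ _ := h5
      _ = _ := by ring
  have hsum := Finset.sum_le_sum (s := Finset.univ) fun i _ => hterm i
  rw [Finset.sum_add_distrib, ← Finset.mul_sum, ← Finset.sum_mul, ← Finset.mul_sum] at hsum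
  rw [dotProduct_sum, Finset.mul_sum, ← Finset.sum_neg_distrib]
  refine hsum.trans ?_
  have hqq := dot_self_nonneg' q
  have : η / D * ∑ i, ρ i * δ i * (r i ⬝ᵥ r i) ≤ η := by
    rw [div_mul_eq_mul_div, div_le_iff₀ hDp]
    nlinarith
  have := mul_le_mul_of_nonneg_right this hqq
  linarith


/-- Theorem 1, item 2: if the initial value of
`V₃ = ∑ (ρᵢ/δᵢ)‖b̄ᵢ‖² + 4 q̄ᵀWq̄ + ‖ω̄‖²` is less than `4 λ_min(W)` and
`q̄₀(0) > 0` (resp. `< 0`), then `b̄ᵢ → 0`, `ω̄ → 0`, `q̄ → 0` and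
`q̄₀ → 1` (resp. `q̄₀ → −1`) as `t → ∞`. -/
theorem stmt16 (m : ℕ) (hm : 2 ≤ m) (r : Fin m → Fin 3 → ℝ)
    (hr : ∃ i j : Fin m, i ≠ j ∧ LinearIndependent ℝ ![r i, r j])
    (α δ ρ : Fin m → ℝ) (hα : ∀ i, 0 < α i) (hδ : ∀ i, 0 < δ i)
    (hρ : ∀ i, 0 < ρ i) (k : ℝ) (hk : 0 < k)
    (W : Matrix (Fin 3) (Fin 3) ℝ)
    (hW : W = -(∑ i, ρ i • (skew (r i) * skew (r i))))
    (lam : ℝ) (hlam : 0 < lam)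
    (hlamMin : IsLeast {t : ℝ | ∃ x : Fin 3 → ℝ, x ≠ 0 ∧ W.mulVec x = t • x} lam)
    (bbar : Fin m → ℝ → Fin 3 → ℝ) (q0 : ℝ → ℝ) (q : ℝ → Fin 3 → ℝ)
    (ωbar : ℝ → Fin 3 → ℝ)
    (hS3 : ∀ t ≥ (0 : ℝ), q0 t ^ 2 + q t ⬝ᵥ q t = 1)
    (hbbar : ∀ i, ∀ t ≥ (0 : ℝ), HasDerivAt (bbar i)
      (-(α i) • bbar i t - (δ i) • (skew (r i)).mulVec (ωbar t)) t)
    (hq0 : ∀ t ≥ (0 : ℝ), HasDerivAt q0 (-(1 / 2) * (q t ⬝ᵥ ωbar t)) t)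
    (hq : ∀ t ≥ (0 : ℝ), HasDerivAt q
      ((1 / 2 : ℝ) • ((q0 t • (1 : Matrix (Fin 3) (Fin 3) ℝ) +
        skew (q t)).mulVec (ωbar t))) t)
    (hωbar : ∀ t ≥ (0 : ℝ), HasDerivAt ωbar
      (-((2 : ℝ) • ((q0 t • (1 : Matrix (Fin 3) (Fin 3) ℝ) -
          skew (q t)).mulVec (W.mulVec (q t)))) -
        (∑ i, ρ i • (skew (r i)).mulVec (bbar i t)) - k • ωbar t) t)
    (hV0 : ∑ i, (ρ i / δ i) * (bbar i 0 ⬝ᵥ bbar i 0) +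
        4 * (q 0 ⬝ᵥ W.mulVec (q 0)) + ωbar 0 ⬝ᵥ ωbar 0 < 4 * lam) :
    (q0 0 > 0 →
      (∀ i, Filter.Tendsto (bbar i) Filter.atTop (nhds 0)) ∧
      Filter.Tendsto ωbar Filter.atTop (nhds 0) ∧
      Filter.Tendsto q Filter.atTop (nhds 0) ∧
      Filter.Tendsto q0 Filter.atTop (nhds 1)) ∧
    (q0 0 < 0 →
      (∀ i, Filter.Tendsto (bbar i) Filter.atTop (nhds 0)) ∧
      Filter.Tendsto ωbar Filter.atTop (nhds 0) ∧
      Filter.Tendsto q Filter.atTop (nhds 0) ∧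
      Filter.Tendsto q0 Filter.atTop (nhds (-1))) := by
  have hWs : Wᵀ = W := by
    rw [hW]
    simp [transpose_sum, transpose_mul, skew_transpose]
  have hR : ∀ x : Fin 3 → ℝ, lam * (x ⬝ᵥ x) ≤ x ⬝ᵥ W.mulVec x :=
    rayleigh W hWs lam (fun t ht => hlamMin.2 ht)
  have hWsym : ∀ x y : Fin 3 → ℝ, x ⬝ᵥ W.mulVec y = y ⬝ᵥ W.mulVec x := by
    intro x y
    rw [dotProduct_mulVec, ← mulVec_transpose, hWs, dotProduct_comm]
  obtain ⟨a, ha, haα⟩ := exists_pos_le α hα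
  set B : ℝ → ℝ := fun t => ∑ i, (ρ i / δ i) * (bbar i t ⬝ᵥ bbar i t) with hB
  set Q : ℝ → ℝ := fun t => q t ⬝ᵥ W.mulVec (q t) with hQ
  set O : ℝ → ℝ := fun t => ωbar t ⬝ᵥ ωbar t with hO
  set N : ℝ → ℝ := fun t => q t ⬝ᵥ q t with hN
  have hρδ : ∀ i, 0 < ρ i / δ i := fun i => div_pos (hρ i) (hδ i)
  have hB0 : ∀ t, 0 ≤ B t := fun t => Finset.sum_nonneg fun i _ =>
    mul_nonneg (hρδ i).le (dot_self_nonneg' _)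
  have hO0 : ∀ t, 0 ≤ O t := fun t => dot_self_nonneg' _
  have hN0 : ∀ t, 0 ≤ N t := fun t => dot_self_nonneg' _
  have hNQ : ∀ t, lam * N t ≤ Q t := fun t => hR _
  have hQ0 : ∀ t, 0 ≤ Q t := fun t => (mul_nonneg hlam.le (hN0 t)).trans (hNQ t)
  set V : ℝ → ℝ := fun t => B t + 4 * Q t + O t with hV
  -- derivative of V
  set V' : ℝ → ℝ := fun t => -2 * (∑ i, α i * ((ρ i / δ i) * (bbar i t ⬝ᵥ bbar i t))) - 2 * k * O t
    with hV'
  have hVd : ∀ t ≥ (0:ℝ), HasDerivAt V (V' t) t := by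
    intro t ht
    have h1 : HasDerivAt B _ t := HasDerivAt.fun_sum (u := Finset.univ) fun i _ =>
      (hasDerivAt_dot (hbbar i t ht) (hbbar i t ht)).const_mul (ρ i / δ i)
    have h2 : HasDerivAt Q _ t := hasDerivAt_dot (hq t ht) (hasDerivAt_mulVec W (hq t ht))
    have h3 : HasDerivAt O _ t := hasDerivAt_dot (hωbar t ht) (hωbar t ht)
    refine ((h1.add (h2.const_mul 4)).add h3).congr_deriv ?_
    have e1 : ∀ i, ρ i / δ i * ((-(α i) • bbar i t - (δ i) • (skew (r i)).mulVec (ωbar t)) ⬝ᵥ bbar i t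
        + bbar i t ⬝ᵥ (-(α i) • bbar i t - (δ i) • (skew (r i)).mulVec (ωbar t))) =
        -2 * (α i * ((ρ i / δ i) * (bbar i t ⬝ᵥ bbar i t))) +
          2 * (ωbar t ⬝ᵥ (ρ i • (skew (r i)).mulVec (bbar i t))) := by
      intro i
      rw [dotProduct_comm _ (bbar i t), dotProduct_sub, dotProduct_smul, dotProduct_smul,
        dotProduct_smul, skew_swap]
      simp only [smul_eq_mul]
      have := (hδ i).ne'
      field_simp
      ring
    rw [Finset.sum_congr rfl fun i _ => e1 i, Finset.sum_add_distrib, ← Finset.mul_sum,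
      ← Finset.mul_sum, ← dotProduct_sum]
    set Y := ∑ i, ρ i • (skew (r i)).mulVec (bbar i t)
    rw [hWsym (q t), ← two_mul, dotProduct_comm _ (ωbar t), ← two_mul]
    have e2 : ((1 / 2 : ℝ) • ((q0 t • (1 : Matrix (Fin 3) (Fin 3) ℝ) +
        skew (q t)).mulVec (ωbar t))) ⬝ᵥ W.mulVec (q t) =
        1 / 2 * (ωbar t ⬝ᵥ ((q0 t • (1 : Matrix (Fin 3) (Fin 3) ℝ) -
          skew (q t)).mulVec (W.mulVec (q t)))) := by
      generalize W.mulVec (q t) = z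
      rw [smul_dotProduct, add_mulVec, sub_mulVec, smul_mulVec, smul_mulVec, one_mulVec,
        one_mulVec, dotProduct_comm, dotProduct_add, dotProduct_sub, skew_swap, dotProduct_smul,
        dotProduct_smul, dotProduct_comm z]
      simp only [smul_eq_mul]
      ring
    rw [e2, dotProduct_sub, dotProduct_sub, dotProduct_neg, dotProduct_smul, dotProduct_smul]
    simp only [smul_eq_mul, hV', hO]
    ring
  have hAB : ∀ t, a * B t ≤ ∑ i, α i * ((ρ i / δ i) * (bbar i t ⬝ᵥ bbar i t)) := by
    intro t
    simp only [hB]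
    rw [Finset.mul_sum]
    exact Finset.sum_le_sum fun i _ => mul_le_mul_of_nonneg_right (haα i)
      (mul_nonneg (hρδ i).le (dot_self_nonneg' _))
  have hV'le : ∀ t, V' t ≤ -2 * a * B t - 2 * k * O t := by
    intro t
    have := hAB t
    simp only [hV']
    linarith
  have hVanti : AntitoneOn V (Set.Ici 0) := by
    apply antitoneOn_of_deriv_nonpos (convex_Ici 0)
    · intro t ht; exact (hVd t ht).continuousAt.continuousWithinAt
    · intro t ht
      rw [interior_Ici] at ht
      exact (hVd t (le_of_lt ht)).differentiableAt.differentiableWithinAt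
    · intro t ht
      rw [interior_Ici] at ht
      rw [(hVd t (le_of_lt ht)).deriv]
      have := hV'le t
      have := mul_nonneg ha.le (hB0 t)
      have := mul_nonneg hk.le (hO0 t)
      linarith
  have hV0' : V 0 < 4 * lam := hV0
  set c : ℝ := 1 - V 0 / (4 * lam) with hc
  have hcp : 0 < c := by
    rw [hc, sub_pos, div_lt_one (by positivity)]; exact hV0'
  have hq0c : ∀ t ≥ (0:ℝ), c ≤ q0 t ^ 2 := by
    intro t ht
    have h1 : V t ≤ V 0 := hVanti (Set.mem_Ici.2 le_rfl) (Set.mem_Ici.2 ht) ht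
    have h2 := hS3 t ht
    have h3 : N t ≤ V 0 / (4 * lam) := by
      rw [le_div_iff₀ (by positivity)]
      have := hNQ t
      have := hB0 t
      have := hO0 t
      simp only [hV] at h1 ⊢
      linarith
    have h2' : q0 t ^ 2 + N t = 1 := h2
    linarith
  have hq01 : ∀ t ≥ (0:ℝ), q0 t ^ 2 ≤ 1 := by
    intro t ht
    have h2' : q0 t ^ 2 + N t = 1 := hS3 t ht
    linarith [hN0 t]
  -- cross term
  set X : ℝ → ℝ := fun t => q0 t * (q t ⬝ᵥ ωbar t) with hX
  have hη : 0 < c * lam / 2 := by positivity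
  obtain ⟨C, hC, hCb⟩ := cross_bound r δ ρ hδ hρ (c * lam / 2) hη
  set C1 : ℝ := 1 / 2 + k ^ 2 / (2 * (c * lam)) with hC1
  have hC1p : 0 < C1 := by positivity
  have hXd : ∀ t ≥ (0:ℝ), ∃ X', HasDerivAt X X' t ∧ X' ≤ -c * Q t + C1 * O t + C * B t := by
    intro t ht
    refine ⟨_, (hq0 t ht).mul (hasDerivAt_dot (hq t ht) (hωbar t ht)), ?_⟩
    have hb := hCb (fun i => bbar i t) (q t) (q0 t) (hq01 t ht)
    set Y := ∑ i, ρ i • (skew (r i)).mulVec (bbar i t)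
    have e1 : ((1 / 2 : ℝ) • ((q0 t • (1 : Matrix (Fin 3) (Fin 3) ℝ) +
        skew (q t)).mulVec (ωbar t))) ⬝ᵥ ωbar t = 1 / 2 * q0 t * O t := by
      have hz : ωbar t ⬝ᵥ (skew (q t)).mulVec (ωbar t) = 0 := by
        have := skew_swap (q t) (ωbar t) (ωbar t)
        linarith
      rw [smul_dotProduct, dotProduct_comm, add_mulVec, smul_mulVec, one_mulVec, dotProduct_add,
        hz, dotProduct_smul]
      simp only [smul_eq_mul, hO]
      ring
    have e2 : q t ⬝ᵥ ((q0 t • (1 : Matrix (Fin 3) (Fin 3) ℝ) -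
          skew (q t)).mulVec (W.mulVec (q t))) = q0 t * Q t := by
      rw [sub_mulVec, smul_mulVec, one_mulVec, dotProduct_sub, skew_self, dotProduct_smul]
      simp [hQ]
    rw [e1, dotProduct_sub, dotProduct_sub, dotProduct_neg, dotProduct_smul, dotProduct_smul, e2]
    simp only [smul_eq_mul]
    have hcs : (q t ⬝ᵥ ωbar t) ^ 2 ≤ N t * O t := dot_sq_le _ _
    have hb' : -(q0 t * (q t ⬝ᵥ Y)) ≤ c * lam / 2 * N t + C * B t := hb
    set w := q t ⬝ᵥ ωbar t
    have g1 : -(k * (q0 t * w)) ≤ c * lam / 2 * N t + k ^ 2 / (2 * (c * lam)) * O t := by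
      set u := c * lam / 2 with hu
      have hk2 : k ^ 2 / (2 * (c * lam)) * O t = k ^ 2 * O t / (4 * u) := by
        rw [hu]; field_simp; try ring
      rw [hk2]
      have h2 : (k * (q0 t * w)) ^ 2 ≤ N t * (k ^ 2 * O t) := by
        have : q0 t ^ 2 * w ^ 2 ≤ N t * O t := by nlinarith [sq_nonneg w, hq01 t ht]
        have := mul_le_mul_of_nonneg_left this (sq_nonneg k)
        nlinarith
      have h3 : (k * (q0 t * w)) ^ 2 ≤ (u * N t + k ^ 2 * O t / (4 * u)) ^ 2 := by
        have : (u * N t + k ^ 2 * O t / (4 * u)) ^ 2 =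
            (u * N t - k ^ 2 * O t / (4 * u)) ^ 2 + N t * (k ^ 2 * O t) := by
          field_simp; ring
        nlinarith [sq_nonneg (u * N t - k ^ 2 * O t / (4 * u))]
      have hO' := hO0 t
      have hN' := hN0 t
      exact (neg_le_abs _).trans (abs_le_of_sq_le_sq h3 (by positivity))
    have g2 : c * Q t ≤ q0 t ^ 2 * Q t := mul_le_mul_of_nonneg_right (hq0c t ht) (hQ0 t)
    have g3 : q0 t ^ 2 * O t ≤ 1 * O t := mul_le_mul_of_nonneg_right (hq01 t ht) (hO0 t)
    have g4 : c * (lam * N t) ≤ c * Q t := mul_le_mul_of_nonneg_left (hNQ t) hcp.le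
    have g5 := sq_nonneg w
    rw [hC1]
    nlinarith
  have hXb : ∀ t ≥ (0:ℝ), |X t| ≤ 1 / 2 * (N t + O t) := by
    intro t ht
    have hcs : (q t ⬝ᵥ ωbar t) ^ 2 ≤ N t * O t := dot_sq_le _ _
    apply abs_le_of_sq_le_sq
    · simp only [hX]
      have : (q0 t * (q t ⬝ᵥ ωbar t)) ^ 2 ≤ N t * O t := by
        rw [mul_pow]; nlinarith [sq_nonneg (q t ⬝ᵥ ωbar t), hq01 t ht]
      nlinarith [sq_nonneg (N t - O t)]
    · have := hN0 t
      have := hO0 t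
      positivity
  obtain ⟨ε, hε, hε1, hε2, hε3, hε4⟩ : ∃ ε > 0, ε * C ≤ a ∧ ε * C1 ≤ k ∧ ε ≤ 1 ∧ ε ≤ 4 * lam := by
    refine ⟨min (min (a / C) (k / C1)) (min 1 (4 * lam)), by positivity, ?_, ?_, ?_, ?_⟩
    · rw [← le_div_iff₀ hC]; exact (min_le_left _ _).trans (min_le_left _ _)
    · rw [← le_div_iff₀ hC1p]; exact (min_le_left _ _).trans (min_le_right _ _)
    · exact (min_le_right _ _).trans (min_le_left _ _)
    · exact (min_le_right _ _).trans (min_le_right _ _)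
  obtain ⟨μ, hμ, hμ1, hμ2, hμ3⟩ : ∃ μ > 0, μ ≤ a ∧ μ ≤ k ∧ 4 * μ ≤ ε * c := by
    refine ⟨min (min a k) (ε * c / 4), by positivity, ?_, ?_, ?_⟩
    · exact (min_le_left _ _).trans (min_le_left _ _)
    · exact (min_le_left _ _).trans (min_le_right _ _)
    · have := min_le_right (min a k) (ε * c / 4)
      linarith
  choose! X' hX'd hX'le using hXd
  have hVn : ∀ t, 0 ≤ V t := by
    intro t
    have := hB0 t
    have := hO0 t
    have := hQ0 t
    simp only [hV]
    positivity
  have hεX : ∀ t ≥ (0:ℝ), |ε * X t| ≤ V t / 2 := by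
    intro t ht
    rw [abs_mul, abs_of_pos hε]
    have h1 := mul_le_mul_of_nonneg_left (hXb t ht) hε.le
    have h2 := mul_le_mul_of_nonneg_right hε3 (hO0 t)
    have h3 := mul_le_mul_of_nonneg_right hε4 (hN0 t)
    have := hNQ t
    have := hB0 t
    simp only [hV]
    linarith
  have hVlim : Filter.Tendsto V Filter.atTop (nhds 0) := by
    refine expdecay (fun t => V t + ε * X t) (fun t => V' t + ε * X' t) V (μ / 2) (by positivity)
      (fun t ht => (hVd t ht).add ((hX'd t ht).const_mul ε)) ?_ (fun t _ => hVn t) ?_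
    · intro t ht
      have h0 := (abs_le.1 (hεX t ht)).2
      have h1 := mul_le_mul_of_nonneg_left (hX'le t ht) hε.le
      have h2 := mul_le_mul_of_nonneg_right hε1 (hB0 t)
      have h3 := mul_le_mul_of_nonneg_right hε2 (hO0 t)
      have h4 := mul_le_mul_of_nonneg_right hμ1 (hB0 t)
      have h5 := mul_le_mul_of_nonneg_right hμ2 (hO0 t)
      have h6 := mul_le_mul_of_nonneg_right hμ3 (hQ0 t)
      have h7 := hV'le t
      have h8 : V' t + ε * X' t ≤ -μ * V t := by
        simp only [hV]
        linarith
      have h9 : μ / 2 * (V t + ε * X t) ≤ μ * V t := by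
        have : V t + ε * X t ≤ 2 * V t := by linarith [hVn t]
        have := mul_le_mul_of_nonneg_left this (by positivity : 0 ≤ μ / 2)
        linarith
      show V' t + ε * X' t ≤ -(μ / 2) * (V t + ε * X t)
      linarith
    · intro t ht
      have h0 := (abs_le.1 (hεX t ht)).1
      show V t ≤ 2 * (V t + ε * X t)
      linarith
  have hblim : ∀ i, Filter.Tendsto (bbar i) Filter.atTop (nhds 0) := by
    intro i
    apply tendsto_zero_of_dot
    have hl : Filter.Tendsto (fun t => V t / (ρ i / δ i)) Filter.atTop (nhds 0) := by
      simpa using hVlim.div_const (ρ i / δ i)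
    refine squeeze_zero (fun t => dot_self_nonneg' _) (fun t => ?_) hl
    rw [le_div_iff₀ (hρδ i)]
    have h1 := Finset.single_le_sum (f := fun j => (ρ j / δ j) * (bbar j t ⬝ᵥ bbar j t))
      (fun j _ => mul_nonneg (hρδ j).le (dot_self_nonneg' _)) (Finset.mem_univ i)
    have h2 : (ρ i / δ i) * (bbar i t ⬝ᵥ bbar i t) ≤ B t := h1
    have := hQ0 t
    have := hO0 t
    simp only [hV]
    linarith
  have hωlim : Filter.Tendsto ωbar Filter.atTop (nhds 0) := by
    apply tendsto_zero_of_dot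
    refine squeeze_zero (fun t => dot_self_nonneg' _) (fun t => ?_) hVlim
    have := hQ0 t
    have := hB0 t
    show O t ≤ V t
    simp only [hV]
    linarith
  have hNlim : Filter.Tendsto N Filter.atTop (nhds 0) := by
    have hl : Filter.Tendsto (fun t => V t / lam) Filter.atTop (nhds 0) := by
      simpa using hVlim.div_const lam
    refine squeeze_zero hN0 (fun t => ?_) hl
    rw [le_div_iff₀ hlam]
    have := hNQ t
    have := hQ0 t
    have := hB0 t
    have := hO0 t
    simp only [hV]
    linarith
  have hqlim := tendsto_zero_of_dot q hNlim
  have habs : Filter.Tendsto (fun t => Real.sqrt (1 - N t)) Filter.atTop (nhds 1) := by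
    have := (hNlim.const_sub 1).sqrt
    simpa using this
  have habs' : ∀ t ≥ (0:ℝ), Real.sqrt (1 - N t) = |q0 t| := by
    intro t ht
    have h2' : q0 t ^ 2 + N t = 1 := hS3 t ht
    rw [← Real.sqrt_sq_eq_abs, ← h2']
    ring_nf
  have hne : ∀ t ≥ (0:ℝ), q0 t ≠ 0 := by
    intro t ht h0
    have := hq0c t ht
    rw [h0] at this
    norm_num at this
    linarith
  have hcont : ∀ t, ContinuousOn q0 (Set.Icc 0 t) := fun t s hs =>
    (hq0 s hs.1).continuousAt.continuousWithinAt
  refine ⟨fun hpos => ⟨hblim, hωlim, hqlim, ?_⟩, fun hneg => ⟨hblim, hωlim, hqlim, ?_⟩⟩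
  · refine habs.congr' ?_
    filter_upwards [Filter.eventually_ge_atTop 0] with t ht
    rw [habs' t ht, abs_of_nonneg]
    by_contra! hlt
    obtain ⟨s, hs, hs0⟩ := intermediate_value_Icc' ht (hcont t) ⟨hlt.le, hpos.le⟩
    exact hne s hs.1 hs0
  · refine habs.neg.congr' ?_
    filter_upwards [Filter.eventually_ge_atTop 0] with t ht
    rw [habs' t ht, abs_of_nonpos, neg_neg]
    by_contra! hlt
    obtain ⟨s, hs, hs0⟩ := intermediate_value_Icc ht (hcont t) ⟨hneg.le, hlt.le⟩
    exact hne s hs.1 hs0
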